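/- For every integer n ≥ 1 there exists a bijection φ from S_{n−1} × {0, 1, …, n−1} onto S_n such that for every σ ∈ S_{n−1} and every integer c with 0 ≤ c ≤ n−1: den(φ(σ,c)) = den(σ) + c, and for every integer r ≥ 1, exc_r(φ(σ,c)) = exc_r(σ) if 0 ≤ c ≤ exc_r(σ) + r − 1, and exc_r(φ(σ,c)) = exc_r(σ) + 1 otherwise. -/

import Mathlib

open Finset

namespace PaperStmt

/-- 1-based position of `i : Fin n` (so positions run through `1,…,n`). -/
def pos1 {n : ℕ} (i : Fin n) : ℕ := (i : ℕ) + 1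

/-- 1-based value `σ_i` of the permutation `σ` at position `i`. -/
def val1 {n : ℕ} (σ : Equiv.Perm (Fin n)) (i : Fin n) : ℕ := (σ i : ℕ) + 1

/-- The number of inversions of the subsequence of `σ` consisting of the letters at the
positions satisfying `P`: pairs of positions `i < j`, both satisfying `P`,
with `σ_i > σ_j`. -/
def invOn {n : ℕ} (σ : Equiv.Perm (Fin n)) (P : Fin n → Prop) [DecidablePred P] : ℕ :=
  (univ.filter fun p : Fin n × Fin n =>
    p.1 < p.2 ∧ P p.1 ∧ P p.2 ∧ val1 σ p.2 < val1 σ p.1).card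

/-- `inv σ`: the number of inversions of `σ`. -/
def inv {n : ℕ} (σ : Equiv.Perm (Fin n)) : ℕ := invOn σ (fun _ => True)

/-- `Exc(σ)`: the set of excedances, i.e. positions `i` with `σ_i > i`. -/
def excSet {n : ℕ} (σ : Equiv.Perm (Fin n)) : Finset (Fin n) :=
  univ.filter fun i => pos1 i < val1 σ i

/-- `exc σ`: the number of excedances. -/
def exc {n : ℕ} (σ : Equiv.Perm (Fin n)) : ℕ := (excSet σ).card

/-- `exc_r(σ)`: the number of `r`-level excedances, i.e. positions `i ≥ r` with `σ_i > i`. -/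
def excLvl {n : ℕ} (r : ℕ) (σ : Equiv.Perm (Fin n)) : ℕ :=
  (univ.filter fun i => pos1 i < val1 σ i ∧ r ≤ pos1 i).card

/-- Denert's statistic `den σ`. -/
def den {n : ℕ} (σ : Equiv.Perm (Fin n)) : ℕ :=
  ((univ.filter fun i => pos1 i < val1 σ i).sum pos1)
  + invOn σ (fun i => pos1 i < val1 σ i)
  + invOn σ (fun i => ¬ pos1 i < val1 σ i)

/-- The `h`-level Denert statistic `den_h(σ)`. -/
def denLvl {n : ℕ} (h : ℕ) (σ : Equiv.Perm (Fin n)) : ℕ :=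
  ((univ.filter fun i => pos1 i < val1 σ i ∧ h ≤ val1 σ i).sum pos1)
  + invOn σ (fun i => pos1 i < val1 σ i ∧ h ≤ val1 σ i)
  + invOn σ (fun i => ¬ (pos1 i < val1 σ i ∧ h ≤ val1 σ i))

/-- `g exc_ℓ(σ)`: the number of `g`-gap `ℓ`-level excedances,
i.e. positions `i ≥ ℓ` with `σ_i ≥ i + g`. -/
def gexc {n : ℕ} (g l : ℕ) (σ : Equiv.Perm (Fin n)) : ℕ :=
  (univ.filter fun i => pos1 i + g ≤ val1 σ i ∧ l ≤ pos1 i).card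

/-- `gExclp_h(σ)`: the set of `g`-gap `h`-level excedance-letter positions,
i.e. positions `i` with `σ_i ≥ i + g` and `σ_i ≥ h`. -/
def gExclpSet {n : ℕ} (g h : ℕ) (σ : Equiv.Perm (Fin n)) : Finset (Fin n) :=
  univ.filter fun i => pos1 i + g ≤ val1 σ i ∧ h ≤ val1 σ i

/-- The `g`-gap `h`-level Denert statistic `g den_h(σ)`. -/
def gden {n : ℕ} (g h : ℕ) (σ : Equiv.Perm (Fin n)) : ℕ :=
  ((univ.filter fun i => pos1 i + g ≤ val1 σ i ∧ h ≤ val1 σ i).sum fun i => pos1 i + g - 1)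
  + invOn σ (fun i => pos1 i + g ≤ val1 σ i ∧ h ≤ val1 σ i)
  + invOn σ (fun i => ¬ (pos1 i + g ≤ val1 σ i ∧ h ≤ val1 σ i))

/-- `rexc σ`: the number of `r`-excedances, i.e. positions `i` with `σ_i ≥ i + r`. -/
def rexc {n : ℕ} (r : ℕ) (σ : Equiv.Perm (Fin n)) : ℕ :=
  (univ.filter fun i => pos1 i + r ≤ val1 σ i).card

/-- The `r`-Denert statistic `rden σ`. -/
def rden {n : ℕ} (r : ℕ) (σ : Equiv.Perm (Fin n)) : ℕ :=
  ((univ.filter fun i => pos1 i + r ≤ val1 σ i).sum fun i => pos1 i + r - 1)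
  + invOn σ (fun i => pos1 i + r ≤ val1 σ i)
  + invOn σ (fun i => ¬ pos1 i + r ≤ val1 σ i)

/-- Pairs `(i, i+1)` of adjacent positions forming an `r`-descent: `σ_i ≥ σ_{i+1} + r`. -/
def rdesPairs {n : ℕ} (r : ℕ) (σ : Equiv.Perm (Fin n)) : Finset (Fin n × Fin n) :=
  univ.filter fun p => pos1 p.2 = pos1 p.1 + 1 ∧ val1 σ p.2 + r ≤ val1 σ p.1

/-- `rdes σ`: the number of `r`-descents. -/
def rdes {n : ℕ} (r : ℕ) (σ : Equiv.Perm (Fin n)) : ℕ := (rdesPairs r σ).card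

/-- `rmaj σ`: the sum of the `r`-descents plus the number of pairs `i < j`
with `σ_j < σ_i < σ_j + r`. -/
def rmaj {n : ℕ} (r : ℕ) (σ : Equiv.Perm (Fin n)) : ℕ :=
  ((rdesPairs r σ).sum fun p => pos1 p.1)
  + (univ.filter fun p : Fin n × Fin n =>
      p.1 < p.2 ∧ val1 σ p.2 < val1 σ p.1 ∧ val1 σ p.1 < val1 σ p.2 + r).card

/-- `des σ`: the number of descents, i.e. positions `i ∈ [n-1]` with `σ_i > σ_{i+1}`. -/
def des {n : ℕ} (σ : Equiv.Perm (Fin n)) : ℕ :=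
  (univ.filter fun p : Fin n × Fin n =>
    pos1 p.2 = pos1 p.1 + 1 ∧ val1 σ p.2 < val1 σ p.1).card

/-- `maj σ`: the major index, i.e. the sum of the descents of `σ`. -/
def maj {n : ℕ} (σ : Equiv.Perm (Fin n)) : ℕ :=
  ((univ.filter fun p : Fin n × Fin n =>
    pos1 p.2 = pos1 p.1 + 1 ∧ val1 σ p.2 < val1 σ p.1).sum fun p => pos1 p.1)

section Transfer

variable {R : Type*} [CommSemiring R] (q : R)

/-- The `q`-integer `[k] = 1 + q + ⋯ + q^(k-1)`. -/
def qInt (k : ℕ) : R := ∑ i ∈ range k, q ^ i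

lemma qInt_zero : qInt q 0 = 0 := by simp [qInt]

lemma qInt_succ (k : ℕ) : qInt q (k + 1) = 1 + q * qInt q k := by
  simp [qInt, sum_range_succ', mul_sum, pow_succ', add_comm]

/-- The transfer operator of a step at an excedance position. -/
def upOp : (ℕ → R) →ₗ[R] (ℕ → R) where
  toFun p h := qInt q h * (p (h - 1) + p h)
  map_add' p p' := by ext h; simp only [Pi.add_apply]; ring
  map_smul' c p := by ext h; simp only [Pi.smul_apply, smul_eq_mul, RingHom.id_apply]; ring

/-- The transfer operator of a step at a non-excedance position. -/
def downOp : (ℕ → R) →ₗ[R] (ℕ → R) where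
  toFun p h := qInt q (h + 1) * (p h + p (h + 1))
  map_add' p p' := by ext h; simp only [Pi.add_apply]; ring
  map_smul' c p := by ext h; simp only [Pi.smul_apply, smul_eq_mul, RingHom.id_apply]; ring

lemma upOp_apply (p : ℕ → R) (h : ℕ) : upOp q p h = qInt q h * (p (h - 1) + p h) := rfl

lemma downOp_apply (p : ℕ → R) (h : ℕ) :
    downOp q p h = qInt q (h + 1) * (p h + p (h + 1)) := rfl

/-- The relation `D E = q E D + D + E` of the matrix ansatz. -/
lemma downOp_upOp (p : ℕ → R) :
    downOp q (upOp q p) = q • upOp q (downOp q p) + upOp q p + downOp q p := by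
  ext h
  cases h with
  | zero =>
    simp only [upOp_apply, downOp_apply, Pi.add_apply, Pi.smul_apply, smul_eq_mul, qInt_succ,
      qInt_zero]
    simp
  | succ h =>
    simp only [upOp_apply, downOp_apply, Pi.add_apply, Pi.smul_apply, smul_eq_mul, qInt_succ,
      Nat.add_sub_cancel]
    ring

/-- The generating functions, indexed by the final height, of the histories of length `m`
whose excedance positions are the elements of `E` below `m`. -/
def histGF (E : Finset ℕ) : ℕ → ℕ → R
  | 0 => fun h => if h = 0 then 1 else 0
  | m + 1 => if m ∈ E then upOp q (histGF E m) else downOp q (histGF E m)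

lemma histGF_succ_of_mem {E : Finset ℕ} {m : ℕ} (hm : m ∈ E) :
    histGF q E (m + 1) = upOp q (histGF q E m) := by simp [histGF, hm]

lemma histGF_succ_of_notMem {E : Finset ℕ} {m : ℕ} (hm : m ∉ E) :
    histGF q E (m + 1) = downOp q (histGF q E m) := by simp [histGF, hm]

lemma histGF_congr {E E' : Finset ℕ} {m : ℕ} (h : ∀ i < m, i ∈ E ↔ i ∈ E') :
    histGF q E m = histGF q E' m := by
  induction m with
  | zero => rfl
  | succ m ih =>
    have ih := ih fun i hi => h i (hi.trans m.lt_succ_self)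
    have hm := h m m.lt_succ_self
    by_cases hE : m ∈ E
    · rw [histGF_succ_of_mem q hE, histGF_succ_of_mem q (hm.1 hE), ih]
    · rw [histGF_succ_of_notMem q hE, histGF_succ_of_notMem q (mt hm.2 hE), ih]

lemma downOp_histGF {E : Finset ℕ} {m : ℕ} (hE : E ⊆ range m) :
    downOp q (histGF q E m) = qInt q (#E + 1) • histGF q E m
      + ∑ r ∈ E, q ^ #{e ∈ E | r < e} • histGF q (E.erase r) m := by
  induction m generalizing E with
  | zero =>
    obtain rfl : E = ∅ := by simpa using hE
    ext h
    cases h <;> simp [downOp_apply, histGF, qInt]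
  | succ m ih =>
    by_cases hm : m ∈ E
    · obtain ⟨E, hmE, rfl⟩ : ∃ E', m ∉ E' ∧ insert m E' = E :=
        ⟨E.erase m, notMem_erase _ _, insert_erase hm⟩
      have hE' : E ⊆ range m := fun x hx => by
        have := mem_range.1 (hE (mem_insert_of_mem hx))
        have : x ≠ m := fun h => hmE (h ▸ hx)
        simp; omega
      have hlt : ∀ x ∈ E, x < m := fun x hx => mem_range.1 (hE' hx)
      have h1 : histGF q (insert m E) m = histGF q E m :=
        histGF_congr q fun i hi => by simp [hi.ne]
      have h2 : #{e ∈ insert m E | m < e} = 0 := by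
        simp only [card_eq_zero, filter_eq_empty_iff, mem_insert]
        rintro x (rfl | hx)
        · simp
        · exact (hlt x hx).le.not_gt
      have h3 : ∀ r ∈ E, q ^ #{e ∈ insert m E | r < e} •
          histGF q ((insert m E).erase r) (m + 1)
          = q • upOp q (q ^ #{e ∈ E | r < e} • histGF q (E.erase r) m) := fun r hr => by
        have hrm := hlt r hr
        rw [filter_insert, if_pos hrm, card_insert_of_notMem (by simp [hmE]),
          histGF_succ_of_mem q (by simp [hrm.ne']), map_smul, smul_smul, pow_succ']
        congr 2
        exact histGF_congr q fun i hi => by simp [hi.ne]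
      rw [histGF_succ_of_mem q hm, h1, downOp_upOp, sum_insert hmE, h2,
        erase_insert hmE, sum_congr rfl h3, card_insert_of_notMem hmE,
        histGF_succ_of_notMem q hmE, ih hE', qInt_succ q (#E + 1), map_add, map_smul, map_sum,
        ← smul_sum, pow_zero, one_smul, add_smul, one_smul, smul_add, smul_smul]
      abel
    · have hE' : E ⊆ range m := fun x hx => by
        have := mem_range.1 (hE hx)
        have : x ≠ m := fun h => hm (h ▸ hx)
        simp; omega
      rw [histGF_succ_of_notMem q hm, ih hE', map_add, map_smul, map_sum, ← ih hE']
      refine congrArg₂ _ rfl (sum_congr rfl fun r _ => ?_)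
      rw [map_smul, histGF_succ_of_notMem q (by simp [hm])]

end Transfer

section Insertion

/-- The increment of Denert's statistic at which the (`0`-based) position `r` becomes a new
excedance, given the set `E` of excedance positions. -/
def slot (E : Finset ℕ) (r : ℕ) : ℕ := r + 1 + #{e ∈ E | r < e}

/-- The set of excedance positions obtained from `E ⊆ range m` by the insertion of index `c`. -/
def insertExc (m : ℕ) (E : Finset ℕ) (c : ℕ) : Finset ℕ :=
  E ∪ {r ∈ range m \ E | slot E r = c}

lemma slot_lt_slot {E : Finset ℕ} {r s : ℕ} (hs : s ∉ E) (hrs : r < s) :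
    slot E r < slot E s := by
  have h : {e ∈ E | r < e} ⊆ {e ∈ E | s < e} ∪ Ioo r s := fun x hx => by
    have hxs : x ≠ s := fun h => hs (h ▸ (mem_filter.1 hx).1)
    simp only [mem_union, mem_filter, mem_Ioo] at hx ⊢
    simp only [hx.1, true_and]
    omega
  have := (card_le_card h).trans (card_union_le _ _)
  rw [Nat.card_Ioo] at this
  unfold slot
  omega

lemma slot_injOn {E : Finset ℕ} {r s : ℕ} (hr : r ∉ E) (hs : s ∉ E)
    (h : slot E r = slot E s) : r = s := by
  rcases lt_trichotomy r s with hrs | hrs | hrs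
  · exact absurd h (slot_lt_slot hs hrs).ne
  · exact hrs
  · exact absurd h (slot_lt_slot hr hrs).ne'

lemma slot_mem_Ioc {m : ℕ} {E : Finset ℕ} (hE : E ⊆ range m) {r : ℕ}
    (hr : r ∈ range m \ E) : slot E r ∈ Ioc #E m := by
  obtain ⟨hrm, hrE⟩ := mem_sdiff.1 hr
  rw [mem_range] at hrm
  have h1 : E ⊆ {e ∈ E | r < e} ∪ range r := fun x hx => by
    have hxr : x ≠ r := fun h => hrE (h ▸ hx)
    simp only [mem_union, mem_filter, mem_range, hx, true_and]
    omega
  have h2 : {e ∈ E | r < e} ⊆ Ioo r m := fun x hx => by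
    rw [mem_filter] at hx
    exact mem_Ioo.2 ⟨hx.2, mem_range.1 (hE hx.1)⟩
  have h1 := (card_le_card h1).trans (card_union_le _ _)
  have h2 := card_le_card h2
  rw [card_range] at h1
  rw [Nat.card_Ioo] at h2
  rw [mem_Ioc]
  unfold slot
  omega

lemma image_slot {m : ℕ} {E : Finset ℕ} (hE : E ⊆ range m) :
    (range m \ E).image (slot E) = Ioc #E m := by
  refine eq_of_subset_of_card_le (image_subset_iff.2 fun r hr => slot_mem_Ioc hE hr) ?_
  rw [card_image_of_injOn, card_sdiff_of_subset hE, card_range, Nat.card_Ioc]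
  intro r hr s hs h
  rw [mem_coe, mem_sdiff] at hr hs
  exact slot_injOn hr.2 hs.2 h

lemma insertExc_of_le {m c : ℕ} {E : Finset ℕ} (hE : E ⊆ range m) (hc : c ≤ #E) :
    insertExc m E c = E := by
  rw [insertExc, filter_eq_empty_iff.2, union_empty]
  rintro r hr rfl
  exact (mem_Ioc.1 (slot_mem_Ioc hE hr)).1.not_ge hc

lemma insertExc_slot {m r : ℕ} {E : Finset ℕ} (hr : r ∈ range m \ E) :
    insertExc m E (slot E r) = insert r E := by
  have : {s ∈ range m \ E | slot E s = slot E r} = {r} := by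
    ext s
    rw [mem_filter, mem_singleton]
    refine ⟨fun h => slot_injOn (mem_sdiff.1 h.1).2 (mem_sdiff.1 hr).2 h.2, ?_⟩
    rintro rfl
    exact ⟨hr, rfl⟩
  rw [insertExc, this, union_comm, insert_eq]

lemma sum_insertExc {M : Type*} [AddCommMonoid M] {m : ℕ} {E : Finset ℕ} (hE : E ⊆ range m)
    (f : Finset ℕ → ℕ → M) :
    ∑ c ∈ range (m + 1), f (insertExc m E c) c
      = ∑ c ∈ range (#E + 1), f E c + ∑ r ∈ range m \ E, f (insert r E) (slot E r) := by
  have hcard : #E ≤ m := by simpa using card_le_card hE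
  have hu : range (m + 1) = range (#E + 1) ∪ Ioc #E m := by
    ext x; simp only [mem_range, mem_union, mem_Ioc]; omega
  have hd : Disjoint (range (#E + 1)) (Ioc #E m) := by
    rw [disjoint_left]; intro x; simp only [mem_range, mem_Ioc]; omega
  rw [hu, sum_union hd, ← image_slot hE, sum_image]
  · refine congrArg₂ _ (sum_congr rfl fun c hc => ?_) (sum_congr rfl fun r hr => ?_)
    · rw [insertExc_of_le hE (Nat.lt_succ_iff.1 (mem_range.1 hc))]
    · rw [insertExc_slot hr]
  · intro r hr s hs h
    rw [mem_coe, mem_sdiff] at hr hs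
    exact slot_injOn hr.2 hs.2 h

variable {R : Type*} [CommSemiring R] (q : R)

/-- The generating function of the closed histories of length `n`, where a history with
excedance positions `E` is weighted by `F E`. -/
def histSum (n : ℕ) (F : Finset ℕ → R) : R :=
  ∑ E ∈ (range n).powerset, F E * (q ^ (∑ e ∈ E, (e + 1)) * histGF q E n 0)

lemma sum_powerset_erase {M : Type*} [AddCommMonoid M] (s : Finset ℕ)
    (f : Finset ℕ → ℕ → M) :
    ∑ E ∈ s.powerset, ∑ r ∈ E, f (E.erase r) r = ∑ E ∈ s.powerset, ∑ r ∈ s \ E, f E r := by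
  rw [sum_sigma', sum_sigma']
  refine sum_bij' (fun x _ => ⟨x.1.erase x.2, x.2⟩) (fun x _ => ⟨insert x.2 x.1, x.2⟩)
    ?_ ?_ ?_ ?_ ?_
  · rintro ⟨E, r⟩ h
    simp only [mem_sigma, mem_powerset, mem_sdiff] at h ⊢
    exact ⟨(erase_subset _ _).trans h.1, h.1 h.2, notMem_erase _ _⟩
  · rintro ⟨E, r⟩ h
    simp only [mem_sigma, mem_powerset, mem_sdiff] at h ⊢
    exact ⟨insert_subset h.2.1 h.1, mem_insert_self _ _⟩
  · rintro ⟨E, r⟩ h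
    simp only [mem_sigma] at h
    simp [insert_erase h.2]
  · rintro ⟨E, r⟩ h
    simp only [mem_sigma, mem_sdiff] at h
    simp [erase_insert h.2.2]
  · rintro ⟨E, r⟩ h
    rfl

lemma histSum_succ (m : ℕ) (F : Finset ℕ → R) :
    histSum q (m + 1) F
      = histSum q m fun E => ∑ c ∈ range (m + 1), F (insertExc m E c) * q ^ c := by
  have hlast : ∀ E ∈ (range m).powerset, histGF q (insert m E) (m + 1) 0 = 0 := fun E _ => by
    rw [histGF_succ_of_mem q (mem_insert_self _ _), upOp_apply, qInt_zero, zero_mul]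
  have hstep : ∀ E ∈ (range m).powerset,
      F E * (q ^ (∑ e ∈ E, (e + 1)) * histGF q E (m + 1) 0)
        = F E * (q ^ (∑ e ∈ E, (e + 1)) * (qInt q (#E + 1) * histGF q E m 0))
          + ∑ r ∈ E, F (insert r (E.erase r)) * q ^ slot (E.erase r) r *
            (q ^ (∑ e ∈ E.erase r, (e + 1)) * histGF q (E.erase r) m 0) := fun E hE => by
    rw [mem_powerset] at hE
    have hmE : m ∉ E := fun h => by simpa using hE h
    have h := congrFun (downOp_histGF q hE) 0
    simp only [Pi.add_apply, Finset.sum_apply, Pi.smul_apply, smul_eq_mul] at h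
    rw [histGF_succ_of_notMem q hmE, h, mul_add, mul_add, mul_sum, mul_sum]
    refine congrArg₂ _ rfl (sum_congr rfl fun r hr => ?_)
    have hs : {e ∈ E.erase r | r < e} = {e ∈ E | r < e} := by
      ext x; simp only [mem_filter, mem_erase]
      exact ⟨fun h => ⟨h.1.2, h.2⟩, fun h => ⟨⟨h.2.ne', h.1⟩, h.2⟩⟩
    rw [insert_erase hr, slot, hs, ← add_sum_erase _ _ hr]
    ring
  unfold histSum
  rw [range_add_one (n := m), sum_powerset_insert (by simp),
    sum_eq_zero (s := (range m).powerset) (f := fun E => F (insert m E) * _)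
      fun E hE => by rw [hlast E hE, mul_zero, mul_zero], add_zero, sum_congr rfl hstep,
    sum_add_distrib,
    sum_powerset_erase _ fun E r => F (insert r E) * q ^ slot E r *
      (q ^ (∑ e ∈ E, (e + 1)) * histGF q E m 0), ← sum_add_distrib]
  refine sum_congr rfl fun E hE => ?_
  beta_reduce
  rw [← range_add_one, sum_insertExc (mem_powerset.1 hE) fun E c => F E * q ^ c, ← mul_sum,
    add_mul, sum_mul, qInt]
  refine congrArg₂ _ ?_ rfl
  ring

end Insertion

section Code

variable {n : ℕ} (σ τ : Equiv.Perm (Fin n))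

/-- The (`0`-based) excedance positions, as a set of natural numbers. -/
def excPos : Finset ℕ := (excSet σ).map Fin.valEmbedding

/-- The number of letters at the first `m` positions that exceed `m`. -/
def height (m : ℕ) : ℕ := #{j : Fin n | (j : ℕ) < m ∧ m ≤ (σ j : ℕ)}

/-- The number of inversions of Denert's statistic charged to the position `i`. -/
def crossing (i : Fin n) : ℕ :=
  if i < σ i then #{j | j < i ∧ σ i < σ j} else #{j | i < j ∧ σ j < σ i}

variable {σ τ}

lemma mem_excSet {i : Fin n} : i ∈ excSet σ ↔ i < σ i := by
  simp [excSet, pos1, val1]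

lemma mem_excPos {i : Fin n} : (i : ℕ) ∈ excPos σ ↔ i < σ i := by
  rw [excPos, ← Fin.valEmbedding_apply, mem_map', mem_excSet]

lemma excPos_subset : excPos σ ⊆ range n := by
  intro x hx
  obtain ⟨i, -, rfl⟩ := mem_map.1 hx
  simp

lemma lt_apply_iff_of_excPos_eq (hE : excPos σ = excPos τ) (i : Fin n) :
    i < σ i ↔ i < τ i := by
  rw [← mem_excPos, ← mem_excPos, hE]

variable (σ) in
lemma height_eq_card_ge (m : ℕ) :
    height σ m = #{j : Fin n | m ≤ (j : ℕ) ∧ (σ j : ℕ) < m} := by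
  have h1 : #{j : Fin n | (σ j : ℕ) < m} = #{j : Fin n | (j : ℕ) < m} := by
    refine card_equiv σ fun i => by simp
  rw [← card_filter_add_card_filter_not (s := {j : Fin n | (σ j : ℕ) < m}) fun j => (j : ℕ) < m,
    ← card_filter_add_card_filter_not (s := {j : Fin n | (j : ℕ) < m}) fun j => (σ j : ℕ) < m,
    filter_filter, filter_filter, filter_filter, filter_filter] at h1
  simp only [not_lt] at h1
  rw [height]
  simp only [and_comm] at h1 ⊢
  omega

variable (σ) in
lemma height_zero : height σ 0 = 0 := by simp [height]

variable (σ) in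
lemma height_self : height σ n = 0 := by simp [height]

variable (σ) in
lemma height_step (i : Fin n) :
    height σ i + (if i < σ i then 1 else 0)
      = height σ (i + 1) + (if σ.symm i < i then 1 else 0) := by
  have h1 : (univ.filter fun j : Fin n => (j : ℕ) < i ∧ (i : ℕ) ≤ (σ j : ℕ))
      = (univ.filter fun j => j < i ∧ i < σ j) ∪ (univ.filter fun j => j < i ∧ i = σ j) := by
    ext j
    simp only [mem_union, mem_filter, mem_univ, true_and, Fin.lt_def, Fin.ext_iff]
    omega
  have h2 : (univ.filter fun j : Fin n => (j : ℕ) < i + 1 ∧ (i + 1 : ℕ) ≤ (σ j : ℕ))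
      = (univ.filter fun j => j < i ∧ i < σ j) ∪ (univ.filter fun j => j = i ∧ i < σ j) := by
    ext j
    simp only [mem_union, mem_filter, mem_univ, true_and, Fin.lt_def, Fin.ext_iff]
    omega
  have h3 : #{j | j < i ∧ i = σ j} = if σ.symm i < i then 1 else 0 := by
    have : ∀ j, j < i ∧ i = σ j ↔ j = σ.symm i ∧ σ.symm i < i := fun j => by
      rw [← Equiv.symm_apply_eq, eq_comm (b := j)]
      constructor
      · rintro ⟨h, rfl⟩; exact ⟨rfl, h⟩
      · rintro ⟨rfl, h⟩; exact ⟨h, rfl⟩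
    simp only [this]
    split_ifs with h <;> simp [h, filter_eq']
  have h4 : #{j | j = i ∧ i < σ j} = if i < σ i then 1 else 0 := by
    have : ∀ j, j = i ∧ i < σ j ↔ j = i ∧ i < σ i := fun j => by
      constructor <;> (rintro ⟨rfl, h⟩; exact ⟨rfl, h⟩)
    simp only [this]
    split_ifs with h <;> simp [h, filter_eq']
  rw [height, height, h1, h2, card_union_of_disjoint, card_union_of_disjoint, h3, h4]
  · ring
  · rw [disjoint_left]; intro j; simp only [mem_filter, mem_univ, true_and]
    rintro ⟨h, -⟩ ⟨rfl, -⟩; exact h.false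
  · rw [disjoint_left]; intro j; simp only [mem_filter, mem_univ, true_and]
    rintro ⟨-, h⟩ ⟨-, h'⟩; exact h.ne h'

lemma crossing_lt_height {i : Fin n} (hi : i < σ i) : crossing σ i < height σ (i + 1) := by
  rw [crossing, if_pos hi, height, ← Nat.add_one_le_iff,
    ← card_insert_of_notMem (a := i) (by simp)]
  refine card_le_card fun j hj => ?_
  simp only [mem_insert, mem_filter, mem_univ, true_and, Fin.lt_def, Fin.ext_iff] at hi hj ⊢
  rcases hj with hj | hj
  · obtain rfl : j = i := Fin.ext hj
    omega
  · omega

lemma crossing_le_height {i : Fin n} (hi : ¬ i < σ i) : crossing σ i ≤ height σ (i + 1) := by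
  rw [crossing, if_neg hi, height_eq_card_ge]
  refine card_le_card fun j hj => ?_
  simp only [mem_filter, mem_univ, true_and, Fin.lt_def] at hi hj ⊢
  omega

lemma height_lt_of_exc {i : Fin n} (hi : i < σ i) (hστ : σ i < τ i)
    (hc : crossing σ i = crossing τ i)
    (h : ∀ j, i < j → j < σ j → σ j = τ j) :
    height σ (σ i + 1) < height τ (σ i + 1) := by
  rw [crossing, if_pos hi, crossing, if_pos (hi.trans hστ)] at hc
  have h1 : (univ.filter fun j : Fin n => (j : ℕ) < σ i + 1 ∧ (σ i + 1 : ℕ) ≤ σ j)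
      ⊆ (univ.filter fun j => j < i ∧ σ i < σ j)
        ∪ (univ.filter fun j => i < j ∧ j ≤ σ i ∧ σ i < τ j) := fun j hj => by
    simp only [mem_union, mem_filter, mem_univ, true_and, Order.lt_add_one_iff,
      Order.add_one_le_iff, Fin.val_fin_lt, Fin.val_fin_le] at hj ⊢
    rcases lt_trichotomy j i with hji | rfl | hji
    · exact Or.inl ⟨hji, hj.2⟩
    · exact absurd hj.2 (lt_irrefl _)
    · exact Or.inr ⟨hji, hj.1, h j hji (hj.1.trans_lt hj.2) ▸ hj.2⟩
  have h2 : insert i ((univ.filter fun j => j < i ∧ τ i < τ j)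
        ∪ (univ.filter fun j => i < j ∧ j ≤ σ i ∧ σ i < τ j))
      ⊆ (univ.filter fun j : Fin n => (j : ℕ) < σ i + 1 ∧ (σ i + 1 : ℕ) ≤ τ j) := fun j hj => by
    simp only [mem_insert, mem_union, mem_filter, mem_univ, true_and, Order.lt_add_one_iff,
      Order.add_one_le_iff, Fin.val_fin_lt, Fin.val_fin_le] at hj ⊢
    rcases hj with rfl | hj | hj
    · exact ⟨hi.le, hστ⟩
    · exact ⟨(hj.1.trans hi).le, hστ.trans hj.2⟩
    · exact hj.2
  have hd : Disjoint (univ.filter fun j : Fin n => j < i ∧ τ i < τ j)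
      (univ.filter fun j : Fin n => i < j ∧ j ≤ σ i ∧ σ i < τ j) := by
    rw [disjoint_left]; intro j; simp only [mem_filter, mem_univ, true_and]
    exact fun h h' => h.1.asymm h'.1
  have h1 := (card_le_card h1).trans (card_union_le _ _)
  have h2 := card_le_card h2
  rw [card_insert_of_notMem (by simp), card_union_of_disjoint hd] at h2
  unfold height
  omega

lemma height_lt_of_not_exc {i : Fin n} (hi : ¬ i < τ i) (hστ : σ i < τ i)
    (hc : crossing σ i = crossing τ i) (hE : ∀ j, j < σ j ↔ j < τ j)
    (h : ∀ j, j < i → ¬ j < σ j → σ j = τ j) :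
    height τ (τ i) < height σ (τ i) := by
  rw [crossing, if_neg (mt (hE i).1 hi), crossing, if_neg hi] at hc
  rw [not_lt] at hi
  have h1 : (univ.filter fun j : Fin n => (τ i : ℕ) ≤ j ∧ (τ j : ℕ) < τ i)
      ⊆ (univ.filter fun j => i < j ∧ τ j < τ i)
        ∪ (univ.filter fun j => j < i ∧ τ i ≤ j ∧ σ j < τ i) := fun j hj => by
    simp only [mem_union, mem_filter, mem_univ, true_and, Fin.val_fin_lt, Fin.val_fin_le] at hj ⊢
    rcases lt_trichotomy i j with hji | rfl | hji
    · exact Or.inl ⟨hji, hj.2⟩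
    · exact absurd hj.2 (lt_irrefl _)
    · have := h j hji (mt (hE j).1 (hj.2.trans_le hj.1).le.not_gt)
      exact Or.inr ⟨hji, hj.1, this ▸ hj.2⟩
  have h2 : insert i ((univ.filter fun j => i < j ∧ σ j < σ i)
        ∪ (univ.filter fun j => j < i ∧ τ i ≤ j ∧ σ j < τ i))
      ⊆ (univ.filter fun j : Fin n => (τ i : ℕ) ≤ j ∧ (σ j : ℕ) < τ i) := fun j hj => by
    simp only [mem_insert, mem_union, mem_filter, mem_univ, true_and,
      Fin.val_fin_lt, Fin.val_fin_le] at hj ⊢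
    rcases hj with rfl | hj | hj
    · exact ⟨hi, hστ⟩
    · exact ⟨hi.trans hj.1.le, hj.2.trans hστ⟩
    · exact hj.2
  have hd : Disjoint (univ.filter fun j : Fin n => i < j ∧ σ j < σ i)
      (univ.filter fun j : Fin n => j < i ∧ τ i ≤ j ∧ σ j < τ i) := by
    rw [disjoint_left]; intro j; simp only [mem_filter, mem_univ, true_and]
    exact fun h h' => h.1.asymm h'.1
  have h1 := (card_le_card h1).trans (card_union_le _ _)
  have h2 := card_le_card h2
  rw [card_insert_of_notMem (by simp), card_union_of_disjoint hd] at h2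
  rw [height_eq_card_ge, height_eq_card_ge]
  omega

lemma eq_of_code_eq (hE : excPos σ = excPos τ) (hh : ∀ m ≤ n, height σ m = height τ m)
    (hc : ∀ i, crossing σ i = crossing τ i) : σ = τ := by
  have hE := lt_apply_iff_of_excPos_eq hE
  have hexc : ∀ i, i < σ i → σ i = τ i := fun i => by
    induction i using WellFoundedGT.induction with
    | ind i ih =>
      intro hi
      rcases lt_trichotomy (σ i) (τ i) with h | h | h
      · exact absurd (hh _ (σ i).isLt) (height_lt_of_exc hi h (hc i) ih).ne
      · exact h
      · exact absurd (hh _ (τ i).isLt) (height_lt_of_exc ((hE i).1 hi) h (hc i).symm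
          fun j hij hj => (ih j hij ((hE j).2 hj)).symm).ne'
  have hnexc : ∀ i, ¬ i < σ i → σ i = τ i := fun i => by
    induction i using WellFoundedLT.induction with
    | ind i ih =>
      intro hi
      rcases lt_trichotomy (σ i) (τ i) with h | h | h
      · exact absurd (hh _ (τ i).isLt.le)
          (height_lt_of_not_exc (mt (hE i).2 hi) h (hc i) hE ih).ne'
      · exact h
      · exact absurd (hh _ (σ i).isLt.le) (height_lt_of_not_exc hi h (hc i).symm
          (fun j => (hE j).symm) fun j hij hj => (ih j hij (mt (hE j).1 hj)).symm).ne
  refine Equiv.ext fun i => ?_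
  by_cases hi : i < σ i
  · exact hexc i hi
  · exact hnexc i hi

variable (σ) in
lemma den_eq : den σ = ∑ e ∈ excPos σ, (e + 1) + ∑ i, crossing σ i := by
  have h1 : invOn σ (fun i => pos1 i < val1 σ i)
      = ∑ i with i < σ i, #{j | j < i ∧ σ i < σ j} := by
    simp only [invOn, card_filter, sum_filter, ← univ_product_univ, sum_product_right]
    refine sum_congr rfl fun i _ => ?_
    split_ifs with hi
    · refine sum_congr rfl fun j _ => if_congr ?_ rfl rfl
      simp only [pos1, val1, Fin.lt_def] at hi ⊢
      omega
    · refine sum_eq_zero fun j _ => if_neg ?_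
      simp only [pos1, val1, Fin.lt_def] at hi ⊢
      omega
  have h2 : invOn σ (fun i => ¬ pos1 i < val1 σ i)
      = ∑ i with ¬ i < σ i, #{j | i < j ∧ σ j < σ i} := by
    simp only [invOn, card_filter, sum_filter, ← univ_product_univ, sum_product]
    refine sum_congr rfl fun i _ => ?_
    rcases em (¬ i < σ i) with hi | hi
    · rw [if_pos hi]
      refine sum_congr rfl fun j _ => if_congr ?_ rfl rfl
      simp only [pos1, val1, Fin.lt_def] at hi ⊢
      omega
    · rw [if_neg hi]
      refine sum_eq_zero fun j _ => if_neg ?_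
      simp only [pos1, val1, Fin.lt_def] at hi ⊢
      omega
  have h3 : (univ.filter fun i => pos1 i < val1 σ i).sum pos1 = ∑ e ∈ excPos σ, (e + 1) := by
    rw [excPos, sum_map]; rfl
  unfold den crossing
  rw [h1, h2, h3, sum_ite, add_assoc]

end Code

section Histories

/-- The lists obtained from those of `T` by prepending a pair `(h, c)` with `c < w`. -/
def consPairs (h w : ℕ) (T : Finset (List (ℕ × ℕ))) : Finset (List (ℕ × ℕ)) :=
  (range w ×ˢ T).image fun p => (h, p.1) :: p.2

/-- The histories of length `m` and final height `h` with excedance positions `E`, as lists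
of pairs (height, crossing number), the last step first. -/
def hist (E : Finset ℕ) : ℕ → ℕ → Finset (List (ℕ × ℕ))
  | 0, h => if h = 0 then {[]} else ∅
  | m + 1, h =>
    if m ∈ E then consPairs h h (hist E m (h - 1) ∪ hist E m h)
    else consPairs h (h + 1) (hist E m h ∪ hist E m (h + 1))

/-- The sum of the crossing numbers of a history. -/
def weight (l : List (ℕ × ℕ)) : ℕ := (l.map Prod.snd).sum

lemma mem_consPairs {h w c : ℕ} {l : List (ℕ × ℕ)} {T : Finset (List (ℕ × ℕ))} (hc : c < w)
    (hl : l ∈ T) : (h, c) :: l ∈ consPairs h w T :=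
  mem_image.2 ⟨(c, l), mem_product.2 ⟨mem_range.2 hc, hl⟩, rfl⟩

lemma head_of_mem_hist {E : Finset ℕ} {m h : ℕ} {l : List (ℕ × ℕ)} (hl : l ∈ hist E m h) :
    (l.headD (0, 0)).1 = h := by
  cases m with
  | zero =>
    rw [hist] at hl
    split_ifs at hl with hh
    · rw [mem_singleton.1 hl, hh]; rfl
    · simp at hl
  | succ m =>
    rw [hist] at hl
    split_ifs at hl <;>
    · obtain ⟨p, -, rfl⟩ := mem_image.1 hl
      rfl

lemma disjoint_hist (E : Finset ℕ) (m : ℕ) {h h' : ℕ} (hh : h ≠ h') :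
    Disjoint (hist E m h) (hist E m h') := by
  rw [disjoint_left]
  exact fun l hl hl' => hh ((head_of_mem_hist hl).symm.trans (head_of_mem_hist hl'))

variable {R : Type*} [CommSemiring R] (q : R)

lemma sum_consPairs (h w : ℕ) (T : Finset (List (ℕ × ℕ))) :
    ∑ l ∈ consPairs h w T, q ^ weight l = qInt q w * ∑ l ∈ T, q ^ weight l := by
  rw [consPairs, sum_image, sum_product, qInt, sum_mul_sum]
  · simp [weight, pow_add]
  · rintro ⟨c, l⟩ - ⟨c', l'⟩ - h
    simpa using h

lemma sum_hist (E : Finset ℕ) (m h : ℕ) :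
    ∑ l ∈ hist E m h, q ^ weight l = histGF q E m h := by
  induction m generalizing h with
  | zero =>
    by_cases hh : h = 0 <;> simp [hist, histGF, weight, hh]
  | succ m ih =>
    by_cases hm : m ∈ E
    · rw [hist, if_pos hm, sum_consPairs, histGF_succ_of_mem q hm, upOp_apply]
      cases h with
      | zero => simp [qInt_zero]
      | succ h => rw [sum_union (disjoint_hist E m (by omega)), ih, ih]
    · rw [hist, if_neg hm, sum_consPairs, histGF_succ_of_notMem q hm, downOp_apply,
        sum_union (disjoint_hist E m (by omega)), ih, ih]

end Histories

section Encoding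

/-- The list of the pairs `(H (i + 1), c i)` for `i < m`, the last one first. -/
def codeList (H c : ℕ → ℕ) : ℕ → List (ℕ × ℕ)
  | 0 => []
  | m + 1 => (H (m + 1), c m) :: codeList H c m

lemma weight_codeList (H c : ℕ → ℕ) (m : ℕ) :
    weight (codeList H c m) = ∑ i ∈ range m, c i := by
  induction m with
  | zero => rfl
  | succ m ih =>
    rw [sum_range_succ, ← ih, add_comm (weight _)]
    rfl

lemma eq_of_codeList_eq {H c H' c' : ℕ → ℕ} {m : ℕ} (h : codeList H c m = codeList H' c' m) :
    ∀ i < m, H (i + 1) = H' (i + 1) ∧ c i = c' i := by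
  induction m with
  | zero => simp
  | succ m ih =>
    simp only [codeList, List.cons.injEq, Prod.mk.injEq] at h
    intro i hi
    rcases Nat.lt_succ_iff_lt_or_eq.1 hi with hi | rfl
    · exact ih h.2 i hi
    · exact h.1

variable {n : ℕ} (σ : Equiv.Perm (Fin n))

/-- The crossing number of the position `m`, and `0` outside the range of positions. -/
def crossingNat (m : ℕ) : ℕ := if h : m < n then crossing σ ⟨m, h⟩ else 0

lemma codeList_mem_hist {m : ℕ} (hm : m ≤ n) :
    codeList (height σ) (crossingNat σ) m ∈ hist (excPos σ) m (height σ m) := by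
  induction m with
  | zero => simp [codeList, hist, height_zero]
  | succ m ih =>
    have ih := ih (by omega)
    set i : Fin n := ⟨m, hm⟩
    have hE : m ∈ excPos σ ↔ i < σ i := mem_excPos (i := i)
    have hs := height_step σ i
    have hc : crossingNat σ m = crossing σ i := dif_pos hm
    change height σ m + _ = height σ (m + 1) + _ at hs
    rw [hist, codeList]
    by_cases hi : i < σ i
    · rw [if_pos (hE.2 hi)]
      refine mem_consPairs (hc ▸ crossing_lt_height hi) (mem_union.2 ?_)
      rw [if_pos hi] at hs
      split_ifs at hs
      · exact Or.inr (by rwa [show height σ (m + 1) = height σ m by omega])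
      · exact Or.inl (by rwa [show height σ (m + 1) - 1 = height σ m by omega])
    · rw [if_neg (mt hE.1 hi)]
      refine mem_consPairs (Nat.lt_succ_iff.2 (hc ▸ crossing_le_height hi)) (mem_union.2 ?_)
      rw [if_neg hi] at hs
      split_ifs at hs
      · exact Or.inr (by rwa [show height σ (m + 1) + 1 = height σ m by omega])
      · exact Or.inl (by rwa [show height σ (m + 1) = height σ m by omega])

/-- The closed histories of length `n`, together with their sets of excedance positions. -/
def closedHist (n : ℕ) : Finset (Σ _ : Finset ℕ, List (ℕ × ℕ)) :=
  (range n).powerset.sigma fun E => hist E n 0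

/-- The history of a permutation. -/
def toHist : Σ _ : Finset ℕ, List (ℕ × ℕ) :=
  ⟨excPos σ, codeList (height σ) (crossingNat σ) n⟩

lemma toHist_mem : toHist σ ∈ closedHist n := by
  refine mem_sigma.2 ⟨mem_powerset.2 excPos_subset, ?_⟩
  have := codeList_mem_hist σ le_rfl
  rwa [height_self] at this

lemma toHist_injective : Function.Injective (toHist (n := n)) := by
  intro σ τ h
  simp only [toHist, Sigma.mk.injEq, heq_eq_eq] at h
  have hl := eq_of_codeList_eq h.2
  refine eq_of_code_eq h.1 (fun m hm => ?_) fun i => ?_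
  · cases m with
    | zero => rw [height_zero, height_zero]
    | succ m => exact (hl m hm).1
  · simpa [crossingNat] using (hl i i.isLt).2

lemma den_eq_weight :
    den σ = ∑ e ∈ (toHist σ).1, (e + 1) + weight (toHist σ).2 := by
  rw [den_eq, toHist, weight_codeList, ← Fin.sum_univ_eq_sum_range]
  simp [crossingNat]

lemma sum_closedHist {R : Type*} [CommSemiring R] (q : R) (n : ℕ) (F : Finset ℕ → R) :
    ∑ t ∈ closedHist n, F t.1 * q ^ (∑ e ∈ t.1, (e + 1) + weight t.2) = histSum q n F := by
  simp only [closedHist, sum_sigma, histSum, pow_add, ← mul_sum, sum_hist]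

lemma card_closedHist (n : ℕ) : #(closedHist n) = n.factorial := by
  have h : ∀ (n a : ℕ), histSum 1 n (fun _ => a) = a * n.factorial := fun n => by
    induction n with
    | zero => simp [histSum, histGF]
    | succ n ih =>
      intro a
      rw [histSum_succ]
      simp only [one_pow, mul_one, sum_const, card_range, smul_eq_mul]
      rw [ih, Nat.factorial_succ]
      ring
  have := sum_closedHist 1 n fun _ => 1
  rw [h n 1] at this
  simpa using this

lemma image_toHist (n : ℕ) : univ.image (toHist (n := n)) = closedHist n := by
  refine eq_of_subset_of_card_le (image_subset_iff.2 fun σ _ => toHist_mem σ) ?_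
  rw [card_closedHist, card_image_of_injective _ toHist_injective, card_univ,
    Fintype.card_perm, Fintype.card_fin]

lemma sum_perm {R : Type*} [CommSemiring R] (q : R) (n : ℕ) (F : Finset ℕ → R) :
    ∑ σ : Equiv.Perm (Fin n), F (excPos σ) * q ^ den σ = histSum q n F := by
  rw [← sum_closedHist, ← image_toHist, sum_image toHist_injective.injOn]
  refine sum_congr rfl fun σ _ => ?_
  rw [den_eq_weight]
  rfl

lemma sum_perm_succ {R : Type*} [CommSemiring R] (q : R) (m : ℕ) (F : Finset ℕ → R) :
    ∑ x : Equiv.Perm (Fin m) × Fin (m + 1),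
        F (insertExc m (excPos x.1) x.2) * q ^ (den x.1 + x.2)
      = ∑ τ : Equiv.Perm (Fin (m + 1)), F (excPos τ) * q ^ den τ := by
  rw [sum_perm, histSum_succ, ← sum_perm, ← univ_product_univ, sum_product]
  refine sum_congr rfl fun σ _ => ?_
  rw [Fin.sum_univ_eq_sum_range fun c => F (insertExc m (excPos σ) c) * q ^ (den σ + c),
    sum_mul]
  refine sum_congr rfl fun c _ => ?_
  ring

open Polynomial in
lemma card_fiber_eq (m : ℕ) (E : Finset ℕ) (d : ℕ) :
    #{x : Equiv.Perm (Fin m) × Fin (m + 1) |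
        (insertExc m (excPos x.1) x.2, den x.1 + x.2) = (E, d)}
      = #{τ : Equiv.Perm (Fin (m + 1)) | (excPos τ, den τ) = (E, d)} := by
  have h := congrArg (coeff · d) (sum_perm_succ (X : ℕ[X]) m fun E' => if E' = E then 1 else 0)
  simp only [ite_mul, one_mul, zero_mul, finsetSum_coeff, apply_ite (coeff · d), coeff_X_pow,
    coeff_zero, ← ite_and] at h
  simpa only [card_filter, Prod.mk.injEq, eq_comm (b := d)] using h

end Encoding

section Levels

lemma excLvl_eq {n : ℕ} (r : ℕ) (σ : Equiv.Perm (Fin n)) :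
    excLvl r σ = #{e ∈ excPos σ | r ≤ e + 1} := by
  rw [excPos, filter_map, card_map, excSet, filter_filter]
  rfl

lemma level_lt_slot_iff {E : Finset ℕ} {r s : ℕ} (hr : 1 ≤ r) (hs : s ∉ E) :
    #{e ∈ E | r ≤ e + 1} + r - 1 < slot E s ↔ r ≤ s + 1 := by
  unfold slot
  constructor
  · contrapose!
    intro h
    have hsub : {e ∈ E | s < e} ⊆ {e ∈ E | r ≤ e + 1} ∪ Ioo s (r - 1) := fun x hx => by
      rw [mem_filter] at hx
      simp only [mem_union, mem_filter, mem_Ioo, hx.1, true_and]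
      omega
    have := (card_le_card hsub).trans (card_union_le _ _)
    rw [Nat.card_Ioo] at this
    omega
  · intro h
    have hsub : {e ∈ E | r ≤ e + 1} ⊆ {e ∈ E | s < e} ∪ Ico (r - 1) s := fun x hx => by
      rw [mem_filter] at hx
      have hxs : x ≠ s := fun h => hs (h ▸ hx.1)
      simp only [mem_union, mem_filter, mem_Ico, hx.1, true_and]
      omega
    have := (card_le_card hsub).trans (card_union_le _ _)
    rw [Nat.card_Ico] at this
    omega

lemma card_level_insertExc {m c r : ℕ} {E : Finset ℕ} (hE : E ⊆ range m) (hc : c ≤ m)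
    (hr : 1 ≤ r) :
    #{e ∈ insertExc m E c | r ≤ e + 1} = #{e ∈ E | r ≤ e + 1}
      + if #{e ∈ E | r ≤ e + 1} + r - 1 < c then 1 else 0 := by
  rcases le_or_gt c #E with h | h
  · have hsub : E ⊆ {e ∈ E | r ≤ e + 1} ∪ range (r - 1) := fun x hx => by
      simp only [mem_union, mem_filter, mem_range, hx, true_and]
      omega
    have := (card_le_card hsub).trans (card_union_le _ _)
    rw [card_range] at this
    rw [insertExc_of_le hE h, if_neg (by omega), add_zero]
  · obtain ⟨s, hs, rfl⟩ := mem_image.1 ((image_slot hE).symm ▸ mem_Ioc.2 ⟨h, hc⟩)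
    have hsE := (mem_sdiff.1 hs).2
    rw [insertExc_slot hs, filter_insert]
    simp only [level_lt_slot_iff hr hsE]
    split_ifs
    · rw [card_insert_of_notMem (by simp [hsE])]
    · rfl

end Levels

/-- There is a bijection `φ : S_{n-1} × {0,…,n-1} → S_n` with `den(φ(σ,c)) = den(σ) + c`
and, for every `r ≥ 1`, `exc_r(φ(σ,c)) = exc_r(σ)` if `c ≤ exc_r(σ) + r − 1` and
`exc_r(φ(σ,c)) = exc_r(σ) + 1` otherwise. -/
theorem exists_bijection_excLvl_den (n : ℕ) (hn : 1 ≤ n) :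
    ∃ φ : Equiv.Perm (Fin (n - 1)) × Fin n → Equiv.Perm (Fin n),
      Function.Bijective φ ∧
      ∀ (σ : Equiv.Perm (Fin (n - 1))) (c : Fin n),
        den (φ (σ, c)) = den σ + (c : ℕ) ∧
        ∀ r : ℕ, 1 ≤ r →
          (((c : ℕ) ≤ excLvl r σ + r - 1 → excLvl r (φ (σ, c)) = excLvl r σ) ∧
           (excLvl r σ + r - 1 < (c : ℕ) → excLvl r (φ (σ, c)) = excLvl r σ + 1)) := by
  obtain ⟨m, rfl⟩ : ∃ m, n = m + 1 := ⟨n - 1, by omega⟩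
  let key (x : Equiv.Perm (Fin m) × Fin (m + 1)) : Finset ℕ × ℕ :=
    (insertExc m (excPos x.1) x.2, den x.1 + x.2)
  let key' (τ : Equiv.Perm (Fin (m + 1))) : Finset ℕ × ℕ := (excPos τ, den τ)
  have hfib : ∀ k, Nonempty ({x // key x = k} ≃ {τ // key' τ = k}) := fun k => by
    rw [← Fintype.card_eq, Fintype.card_subtype, Fintype.card_subtype]
    exact card_fiber_eq m k.1 k.2
  let φ := Equiv.ofFiberEquiv fun k => (hfib k).some
  have hφ : ∀ x, key' (φ x) = key x := Equiv.ofFiberEquiv_map _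
  refine ⟨φ, φ.bijective, fun (σ : Equiv.Perm (Fin m)) c => ?_⟩
  obtain ⟨hE, hd⟩ := Prod.ext_iff.1 (hφ (σ, c))
  refine ⟨hd, fun r hr => ?_⟩
  have h := card_level_insertExc (excPos_subset (σ := σ)) (Nat.lt_succ_iff.1 c.isLt) hr
  change excPos (φ (σ, c)) = insertExc m (excPos σ) c at hE
  rw [← hE, ← excLvl_eq, ← excLvl_eq] at h
  exact ⟨fun hc => by rw [h, if_neg hc.not_gt, add_zero], fun hc => by rw [h, if_pos hc]⟩

end PaperStmt
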